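/- Stein's-method bound on the Wasserstein distance: if R is a real-valued random variable and Z has a standard normal distribution, and ℱ is the family of twice-differentiable functions f: R → R with ‖f‖_∞ ≤ 2, ‖f′‖_∞ ≤ √(2/π), and ‖f″‖_∞ ≤ 2, then d_W(R, Z) ≤ sup_{f ∈ ℱ} |E[f′(R) − R f(R)]|. -/

import Mathlib

namespace SteinAux
open MeasureTheory ProbabilityTheory Filter Topology Set

noncomputable def sPhi (x : ℝ) : ℝ := Real.exp (-x^2/2)
noncomputable def sA (x : ℝ) : ℝ := ∫ t in Iic x, sPhi t
noncomputable def sB (x : ℝ) : ℝ := ∫ t in Ioi x, sPhi t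

lemma sPhi_pos (x : ℝ) : 0 < sPhi x := Real.exp_pos _
lemma sPhi_le (x : ℝ) : sPhi x ≤ 1 := by
  unfold sPhi; rw [Real.exp_le_one_iff]; nlinarith [sq_nonneg x]
lemma sPhi_neg (x : ℝ) : sPhi (-x) = sPhi x := by simp [sPhi]
lemma sPhi_eq : sPhi = fun x => Real.exp (-(1/2) * x^2) := by
  funext x; unfold sPhi; congr 1; ring
lemma sPhi_cont : Continuous sPhi := by unfold sPhi; fun_prop
lemma sPhi_int : Integrable sPhi := by
  rw [sPhi_eq]; exact integrable_exp_neg_mul_sq (by norm_num)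
lemma sPhi_int1 : Integrable (fun t => t * sPhi t) := by
  rw [sPhi_eq]; exact integrable_mul_exp_neg_mul_sq (by norm_num)
lemma sPhi_deriv (x : ℝ) : HasDerivAt sPhi (-x * sPhi x) x := by
  unfold sPhi
  have h : HasDerivAt (fun x : ℝ => -x^2/2) (-x) x := by
    have := ((hasDerivAt_pow 2 x).neg.div_const 2)
    exact this.congr_deriv (by simp; try ring)
  convert h.exp using 1; ring
lemma sPhi_top : Tendsto sPhi atTop (𝓝 0) := by
  unfold sPhi
  apply Real.tendsto_exp_atBot.comp
  have : Tendsto (fun x : ℝ => x^2/2) atTop atTop :=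
    (tendsto_pow_atTop (by norm_num)).atTop_div_const (by norm_num)
  have := tendsto_neg_atTop_atBot.comp this
  refine this.congr fun x => ?_
  simp; ring
lemma sPhi_bot : Tendsto sPhi atBot (𝓝 0) := by
  have := sPhi_top.comp tendsto_neg_atBot_atTop
  exact this.congr fun x => sPhi_neg x

lemma Iic_deriv {u : ℝ → ℝ} (hu : Continuous u) (hi : Integrable u) (x : ℝ) :
    HasDerivAt (fun x => ∫ t in Iic x, u t) (u x) x := by
  have h : (fun x => ∫ t in Iic x, u t) = fun x => (∫ t in (0:ℝ)..x, u t) + ∫ t in Iic 0, u t := by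
    funext y
    rw [← intervalIntegral.integral_Iic_sub_Iic hi.integrableOn hi.integrableOn]; ring
  rw [h]
  exact (intervalIntegral.integral_hasDerivAt_right (hu.intervalIntegrable _ _)
    (hu.stronglyMeasurableAtFilter _ _) hu.continuousAt).add_const _

lemma Iic_add_Ioi {u : ℝ → ℝ} (hi : Integrable u) (x : ℝ) :
    (∫ t in Iic x, u t) + ∫ t in Ioi x, u t = ∫ t, u t := by
  have := integral_add_compl (measurableSet_Iic (a := x)) hi
  rwa [compl_Iic] at this

lemma sPhi_total : ∫ t, sPhi t = √(2 * Real.pi) := by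
  rw [sPhi_eq, integral_gaussian]; congr 1; field_simp
lemma sA_add_sB (x : ℝ) : sA x + sB x = √(2 * Real.pi) := by
  rw [← sPhi_total]; exact Iic_add_Ioi sPhi_int x
lemma sA_deriv (x : ℝ) : HasDerivAt sA (sPhi x) x := Iic_deriv sPhi_cont sPhi_int x
lemma sB_deriv (x : ℝ) : HasDerivAt sB (-sPhi x) x := by
  have : sB = fun x => √(2 * Real.pi) - sA x := by
    funext y; rw [← sA_add_sB y]; ring
  rw [this]; simpa using (sA_deriv x).const_sub (√(2 * Real.pi))
lemma sA_neg (x : ℝ) : sA (-x) = sB x := by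
  unfold sA sB
  have := integral_comp_neg_Iic (-x) sPhi
  simpa [sPhi_neg] using this
lemma sB_neg (x : ℝ) : sB (-x) = sA x := by
  rw [← sA_neg, neg_neg]
lemma sB_top : Tendsto sB atTop (𝓝 0) := by
  have h : Tendsto (fun y => ∫ t in Iic y, sPhi t) atTop (𝓝 (∫ t, sPhi t)) := by
    have := (aecover_Iic (μ := volume) (tendsto_id (α := ℝ) (x := atTop))).integral_tendsto_of_countably_generated sPhi_int
    simpa using this
  have h2 : sB = fun x => (∫ t, sPhi t) - ∫ t in Iic x, sPhi t := by
    funext y; rw [← Iic_add_Ioi sPhi_int y]; unfold sB; ring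
  rw [h2]; simpa using h.const_sub (∫ t, sPhi t)
lemma sA_top : Tendsto sA atTop (𝓝 √(2 * Real.pi)) := by
  have h2 : sA = fun x => √(2 * Real.pi) - sB x := by
    funext y; rw [← sA_add_sB y]; ring
  rw [h2]; simpa using sB_top.const_sub _
lemma sB_nonneg (x : ℝ) : 0 ≤ sB x := integral_nonneg fun t => (sPhi_pos t).le
lemma sA_nonneg (x : ℝ) : 0 ≤ sA x := integral_nonneg fun t => (sPhi_pos t).le

lemma Ioi_mul (x : ℝ) : ∫ t in Ioi x, t * sPhi t = sPhi x := by
  have := integral_Ioi_of_hasDerivAt_of_tendsto' (a := x) (f := fun t => - sPhi t) (f' := fun t => t * sPhi t)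
    (m := 0) (fun t _ => (sPhi_deriv t).neg.congr_deriv (by ring)) sPhi_int1.integrableOn
    (by simpa using sPhi_top.neg)
  simpa using this
lemma Iic_mul (x : ℝ) : ∫ t in Iic x, t * sPhi t = - sPhi x := by
  have := integral_Iic_of_hasDerivAt_of_tendsto' (a := x) (f := fun t => - sPhi t) (f' := fun t => t * sPhi t)
    (m := 0) (fun t _ => (sPhi_deriv t).neg.congr_deriv (by ring)) sPhi_int1.integrableOn
    (by simpa using sPhi_bot.neg)
  simpa using this

lemma Ioi_abs (x : ℝ) : ∫ t in Ioi x, (t - x) * sPhi t = sPhi x - x * sB x := by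
  simp_rw [sub_mul]
  rw [integral_sub sPhi_int1.integrableOn (sPhi_int.const_mul x).integrableOn, Ioi_mul,
    integral_const_mul]; rfl
lemma Iic_abs (x : ℝ) : ∫ t in Iic x, (x - t) * sPhi t = x * sA x + sPhi x := by
  simp_rw [sub_mul]
  rw [integral_sub (sPhi_int.const_mul x).integrableOn sPhi_int1.integrableOn, Iic_mul,
    integral_const_mul]; unfold sA; ring

/-- Mills -/
lemma mills (x : ℝ) : x * sPhi x ≤ (1 + x^2) * sB x := by
  have hd : ∀ y, HasDerivAt (fun y => sB y - y * sPhi y / (1 + y^2)) (-2 * sPhi y / (1+y^2)^2) y := by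
    intro y
    have hne : (1 + y^2) ≠ 0 := by positivity
    have h1 : HasDerivAt (fun y : ℝ => 1 + y^2) (2 * y) y := by
      simpa using (hasDerivAt_pow 2 y).const_add 1
    have := (sB_deriv y).sub ((((hasDerivAt_id y).mul (sPhi_deriv y)).div h1 hne))
    refine this.congr_deriv ?_
    simp only [id, Pi.mul_apply]; field_simp; ring
  have hanti : Antitone (fun y => sB y - y * sPhi y / (1 + y^2)) := by
    apply antitone_of_hasDerivAt_nonpos hd
    intro y
    have := sPhi_pos y
    have : 0 ≤ 2 * sPhi y / (1+y^2)^2 := by positivity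
    simp only [Pi.zero_apply]; 
    rw [neg_mul, neg_div]; linarith
  have hlim : Tendsto (fun y => sB y - y * sPhi y / (1 + y^2)) atTop (𝓝 0) := by
    have : Tendsto (fun y => y * sPhi y / (1 + y^2)) atTop (𝓝 0) := by
      apply squeeze_zero' (g := sPhi) _ _ sPhi_top
      · filter_upwards [eventually_ge_atTop 0] with y hy
        have := sPhi_pos y
        positivity
      · filter_upwards [eventually_ge_atTop 0] with y hy
        have := sPhi_pos y
        rw [div_le_iff₀ (by positivity)]
        nlinarith [mul_nonneg this.le (sq_nonneg (y-1)), mul_nonneg this.le (sq_nonneg y)]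
    simpa using sB_top.sub this
  have := hanti.le_of_tendsto hlim x
  have h2 : x * sPhi x / (1 + x^2) ≤ sB x := by linarith
  rw [div_le_iff₀ (by positivity)] at h2
  linarith
lemma mills' (x : ℝ) : 0 ≤ (1 + x^2) * sA x + x * sPhi x := by
  have := mills (-x)
  rw [sPhi_neg, sB_neg] at this
  nlinarith

lemma key_pos {x : ℝ} (hx : 0 < x) :
    (sPhi x - x * sB x) * (x * sA x + sPhi x) ≤ sPhi x := by
  have e1 : ∀ y, 0 ≤ y → sA y - sB y ≤ 2 * y := by
    have hm : MonotoneOn (fun y => 2 * y - (sA y - sB y)) (Ici 0) := by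
      apply Monotone.monotoneOn
      apply monotone_of_hasDerivAt_nonneg (f' := fun y => 2 - 2 * sPhi y)
      · intro y
        have := ((hasDerivAt_id y).const_mul 2).sub ((sA_deriv y).sub (sB_deriv y))
        exact this.congr_deriv (by ring)
      · intro y; simp only [Pi.zero_apply]; linarith [sPhi_le y]
    intro y hy
    have := hm (by simp) hy hy
    have h0 : sA 0 = sB 0 := by simpa using sA_neg 0
    simp only [h0] at this; linarith
  have e2 : ∀ y, 0 ≤ y → (sA y - sB y) * y ≤ y^2 + 2 * (1 - sPhi y) := by
    have hm : MonotoneOn (fun y => y^2 + 2 * (1 - sPhi y) - (sA y - sB y) * y) (Ici 0) := by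
      have hd : ∀ y, HasDerivAt (fun y => y^2 + 2 * (1 - sPhi y) - (sA y - sB y) * y)
          (2 * y - (sA y - sB y)) y := by
        intro y
        have := ((hasDerivAt_pow 2 y).add (((sPhi_deriv y).const_sub 1).const_mul 2)).sub
          (((sA_deriv y).sub (sB_deriv y)).mul (hasDerivAt_id y))
        exact this.congr_deriv (by simp; ring)
      apply monotoneOn_of_hasDerivWithinAt_nonneg (convex_Ici 0)
        (fun y _ => (hd y).continuousAt.continuousWithinAt) (fun y _ => (hd y).hasDerivWithinAt)
      intro y hy
      simp at hy
      linarith [e1 y hy.le]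
    intro y hy
    have := hm (by simp) hy hy
    simp [sPhi] at this; simp [sPhi]; linarith
  let G : ℝ → ℝ := fun y => sA y * sB y + sPhi y * (1 - sPhi y) / y^2 - sPhi y * (sA y - sB y) / y
  have hd : ∀ y, 0 < y → HasDerivAt G
      (sPhi y / y^3 * ((sA y - sB y) * y - (y^2 + 2 * (1 - sPhi y)))) y := by
    intro y hy
    have := (((sA_deriv y).mul (sB_deriv y)).add (((sPhi_deriv y).mul ((sPhi_deriv y).const_sub 1)).div
      (hasDerivAt_pow 2 y) (by positivity))).sub
      (((sPhi_deriv y).mul ((sA_deriv y).sub (sB_deriv y))).div (hasDerivAt_id y) hy.ne')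
    refine this.congr_deriv ?_
    simp; field_simp; ring
  have hanti : AntitoneOn G (Ioi 0) := by
    apply antitoneOn_of_hasDerivWithinAt_nonpos (convex_Ioi 0)
        (fun y hy => (hd y hy).continuousAt.continuousWithinAt)
        (fun y hy => (hd y (by simpa using hy)).hasDerivWithinAt)
    intro y hy
    simp at hy
    have := sPhi_pos y
    apply mul_nonpos_of_nonneg_of_nonpos (by positivity)
    linarith [e2 y hy.le]
  have hlim : Tendsto G atTop (𝓝 0) := by
    have hinv : Tendsto (fun y : ℝ => y⁻¹) atTop (𝓝 0) := tendsto_inv_atTop_zero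
    have h1 := ((sA_top.mul sB_top).add ((sPhi_top.mul (sPhi_top.const_sub 1)).mul (hinv.pow 2))).sub
      ((sPhi_top.mul (sA_top.sub sB_top)).mul hinv)
    simp at h1
    refine h1.congr fun y => ?_
    simp [G, div_eq_mul_inv]
  have hG : 0 ≤ G x := by
    apply le_of_tendsto hlim
    filter_upwards [eventually_ge_atTop x] with y hy
    exact hanti hx (hx.trans_le hy) hy
  have h3 : 0 ≤ x^2 * G x := by positivity
  have h4 : x^2 * G x = x^2 * (sA x * sB x) + sPhi x * (1 - sPhi x) - x * sPhi x * (sA x - sB x) := by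
    simp only [G]; field_simp
  rw [h4] at h3
  nlinarith

lemma key (x : ℝ) : (sPhi x - x * sB x) * (x * sA x + sPhi x) ≤ sPhi x := by
  rcases lt_trichotomy x 0 with h | h | h
  · have := key_pos (x := -x) (by linarith)
    rw [sPhi_neg, sB_neg, sA_neg] at this
    nlinarith
  · subst h; simp [sPhi]
  · exact key_pos h

lemma alg {x A B φ P Q g0 f d : ℝ} (hφ : 0 < φ) (hA : 0 ≤ A) (hB : 0 ≤ B) (hS : A + B = √(2 * Real.pi))
    (m1 : x * φ ≤ (1 + x^2) * B) (m2 : 0 ≤ (1 + x^2) * A + x * φ)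
    (hk : (φ - x * B) * (x * A + φ) ≤ φ)
    (hP : |P| ≤ x * A + φ) (hQ : |Q| ≤ φ - x * B)
    (hg : g0 * (A + B) = -(P + Q)) (hf : f * φ = g0 * A + P) (hd : |d| ≤ 1) :
    |f| ≤ 2 ∧ |x * f + g0| ≤ √(2 / Real.pi) ∧ |f + x * (x * f + g0) + d| ≤ 2 := by
  have hSp : 0 < A + B := by rw [hS]; positivity
  have hfe : f * (φ * (A + B)) = B * P - A * Q := by linear_combination (A + B) * hf + A * hg
  obtain ⟨p1, p2⟩ := abs_le.1 hP
  obtain ⟨q1, q2⟩ := abs_le.1 hQ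
  have gen : ∀ {u a b c K : ℝ}, 0 ≤ a → 0 ≤ b → u * c = a * P - b * Q → 0 < c →
      a * (x * A + φ) + b * (φ - x * B) ≤ K * c → |u| ≤ K := by
    intro u a b c K ha hb hu hc hK
    have h1 := mul_le_mul_of_nonneg_left p1 ha
    have h2 := mul_le_mul_of_nonneg_left p2 ha
    have h3 := mul_le_mul_of_nonneg_left q1 hb
    have h4 := mul_le_mul_of_nonneg_left q2 hb
    rw [abs_le]
    constructor
    · apply le_of_mul_le_mul_right _ hc; linarith
    · apply le_of_mul_le_mul_right _ hc; linarith
  have hc : 0 < φ * (A + B) := by positivity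
  refine ⟨?_, ?_, ?_⟩
  · apply gen hB hA hfe hc
    nlinarith
  · have hα : 0 ≤ φ - x * B := (abs_nonneg _).trans hQ
    have hβ : 0 ≤ x * A + φ := (abs_nonneg _).trans hP
    rw [← abs_neg]
    have hu : -(x * f + g0) * (φ * (A + B)) = (φ - x * B) * P - (-(x * A + φ)) * Q := by
      linear_combination (-x) * hfe - φ * hg
    have hpi : √(2 / Real.pi) * (A + B) = 2 := by
      rw [hS, ← Real.sqrt_mul (by positivity)]
      rw [show 2 / Real.pi * (2 * Real.pi) = 2^2 by field_simp]
      simp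
    have h2 : |(φ - x * B) * P + (x * A + φ) * Q| ≤ 2 * φ := by
      refine (abs_add_le _ _).trans ?_
      rw [abs_mul, abs_mul, abs_of_nonneg hα, abs_of_nonneg hβ]
      have := mul_le_mul_of_nonneg_left hP hα
      have := mul_le_mul_of_nonneg_left hQ hβ
      nlinarith
    apply le_of_mul_le_mul_right _ hc
    rw [← abs_of_pos hc, ← abs_mul, hu, abs_of_pos hc]
    calc _ = |(φ - x * B) * P + (x * A + φ) * Q| := by congr 1; ring
      _ ≤ 2 * φ := h2
      _ = _ := by linear_combination (-φ) * hpi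
  · have : |f + x * (x * f + g0)| ≤ 1 := by
      apply gen (a := (1 + x^2) * B - x * φ) (b := (1 + x^2) * A + x * φ) (by linarith) m2 _ hc
      · apply le_of_eq; ring
      · linear_combination (1 + x^2) * hfe + x * φ * hg
    refine (abs_add_le _ _).trans ?_
    linarith

lemma lip_abs {h : ℝ → ℝ} (hL : LipschitzWith 1 h) (s t : ℝ) : |h s - h t| ≤ |s - t| := by
  simpa [Real.dist_eq] using hL.dist_le_mul s t

lemma lip_int {Ω : Type*} [MeasurableSpace Ω] {μ : Measure Ω} [IsFiniteMeasure μ] {R : Ω → ℝ}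
    (hR : Integrable R μ) {h : ℝ → ℝ} (hL : LipschitzWith 1 h) :
    Integrable (fun ω => h (R ω)) μ := by
  refine ((integrable_const |h 0|).add hR.abs).mono'
    (hL.continuous.comp_aestronglyMeasurable hR.aestronglyMeasurable) (ae_of_all _ fun ω => ?_)
  have h1 := lip_abs hL (R ω) 0
  have h2 := abs_add_le (h (R ω) - h 0) (h 0)
  simp only [sub_add_cancel, sub_zero, Real.norm_eq_abs, Pi.add_apply] at *
  linarith

lemma lip_int_phi {h : ℝ → ℝ} (hL : LipschitzWith 1 h) : Integrable (fun t => h t * sPhi t) := by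
  refine ((sPhi_int.const_mul |h 0|).add sPhi_int1.abs).mono'
    (hL.continuous.mul sPhi_cont).aestronglyMeasurable (ae_of_all _ fun t => ?_)
  have h1 := lip_abs hL t 0
  have h2 := abs_add_le (h t - h 0) (h 0)
  have hp := sPhi_pos t
  simp only [sub_add_cancel, sub_zero, Real.norm_eq_abs, Pi.add_apply, abs_mul, abs_of_pos hp] at *
  nlinarith

lemma gauss_eq (h : ℝ → ℝ) :
    (∫ x, h x ∂(gaussianReal 0 1)) * √(2 * Real.pi) = ∫ t, h t * sPhi t := by
  rw [integral_gaussianReal_eq_integral_smul (by norm_num), ← integral_mul_const]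
  congr 1; funext t
  have : √(2 * Real.pi) ≠ 0 := by positivity
  simp only [gaussianPDFReal, sPhi, smul_eq_mul, sub_zero, NNReal.coe_one, mul_one]
  field_simp

lemma stein_sol {h : ℝ → ℝ} (hL : LipschitzWith 1 h) (hD : Differentiable ℝ h) :
    ∃ f : ℝ → ℝ, (Differentiable ℝ f ∧ Differentiable ℝ (deriv f) ∧
          (∀ x, |f x| ≤ 2) ∧ (∀ x, |deriv f x| ≤ Real.sqrt (2 / Real.pi)) ∧
          (∀ x, |deriv (deriv f) x| ≤ 2)) ∧
      ∀ x, deriv f x - x * f x = h x - ∫ x, h x ∂(gaussianReal 0 1) := by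
  set c := ∫ x, h x ∂(gaussianReal 0 1) with hc
  let u : ℝ → ℝ := fun t => (h t - c) * sPhi t
  have hui : Integrable u := by
    have := (lip_int_phi hL).sub (sPhi_int.const_mul c)
    refine this.congr (ae_of_all _ fun t => ?_)
    simp [u]; ring
  have huc : Continuous u := (hL.continuous.sub continuous_const).mul sPhi_cont
  have hu0 : ∫ t, u t = 0 := by
    have : u = fun t => h t * sPhi t - c * sPhi t := by funext t; simp [u]; ring
    rw [this, integral_sub (lip_int_phi hL) (sPhi_int.const_mul c), integral_const_mul, sPhi_total,
      ← gauss_eq]; ring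
  let f : ℝ → ℝ := fun x => (∫ t in Iic x, u t) / sPhi x
  have hf : ∀ x, HasDerivAt f (x * f x + (h x - c)) x := by
    intro x
    have hp := (sPhi_pos x).ne'
    refine ((Iic_deriv huc hui x).div (sPhi_deriv x) hp).congr_deriv ?_
    simp only [f, u]; field_simp; ring
  have hfd : deriv f = fun x => x * f x + (h x - c) := funext fun x => (hf x).deriv
  have hf2 : ∀ x, HasDerivAt (deriv f) (f x + x * (x * f x + (h x - c)) + deriv h x) x := by
    intro x
    rw [hfd]
    refine (((hasDerivAt_id x).mul (hf x)).add ((hD x).hasDerivAt.sub_const c)).congr_deriv ?_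
    simp
  have hd : ∀ x, |deriv h x| ≤ 1 := fun x => by
    simpa using norm_deriv_le_of_lipschitz (x₀ := x) hL
  have main : ∀ x, |f x| ≤ 2 ∧ |x * f x + (h x - c)| ≤ √(2 / Real.pi) ∧
      |f x + x * (x * f x + (h x - c)) + deriv h x| ≤ 2 := by
    intro x
    have hvi : Integrable (fun t => (h t - h x) * sPhi t) := by
      refine ((lip_int_phi hL).sub (sPhi_int.const_mul (h x))).congr (ae_of_all _ fun t => ?_)
      simp; ring
    have hsum : ∀ s : Set ℝ, ∫ t in s, u t =
        (h x - c) * (∫ t in s, sPhi t) + ∫ t in s, (h t - h x) * sPhi t := by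
      intro s
      rw [← integral_const_mul, ← integral_add (sPhi_int.const_mul _).integrableOn hvi.integrableOn]
      congr 1; funext t; simp only [u]; ring
    apply alg (P := ∫ t in Iic x, (h t - h x) * sPhi t) (Q := ∫ t in Ioi x, (h t - h x) * sPhi t)
      (sPhi_pos x) (sA_nonneg x) (sB_nonneg x) (sA_add_sB x) (mills x) (mills' x) (key x)
    · rw [← Iic_abs]
      refine norm_integral_le_of_norm_le (f := fun t => (h t - h x) * sPhi t)
        (μ := volume.restrict (Iic x)) (g := fun t => (x - t) * sPhi t) ?_ ?_
      · refine (((sPhi_int.const_mul x).sub sPhi_int1).congr (ae_of_all _ fun t => ?_)).integrableOn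
        simp; ring
      · filter_upwards [ae_restrict_mem measurableSet_Iic] with t ht
        rw [norm_mul, Real.norm_eq_abs, Real.norm_eq_abs, abs_of_pos (sPhi_pos t)]
        refine mul_le_mul_of_nonneg_right ?_ (sPhi_pos t).le
        have := lip_abs hL t x
        rwa [abs_sub_comm t x, abs_of_nonneg (a := x - t) (sub_nonneg.2 ht)] at this
    · rw [← Ioi_abs]
      refine norm_integral_le_of_norm_le (f := fun t => (h t - h x) * sPhi t)
        (μ := volume.restrict (Ioi x)) (g := fun t => (t - x) * sPhi t) ?_ ?_
      · refine ((sPhi_int1.sub (sPhi_int.const_mul x)).congr (ae_of_all _ fun t => ?_)).integrableOn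
        simp; ring
      · filter_upwards [ae_restrict_mem measurableSet_Ioi] with t ht
        rw [norm_mul, Real.norm_eq_abs, Real.norm_eq_abs, abs_of_pos (sPhi_pos t)]
        refine mul_le_mul_of_nonneg_right ?_ (sPhi_pos t).le
        have := lip_abs hL t x
        rwa [abs_of_nonneg (a := t - x) (sub_nonneg.2 (le_of_lt ht))] at this
    · have h1 := Iic_add_Ioi hui x
      rw [hu0, hsum, hsum] at h1
      unfold sA sB; linarith
    · have hp := (sPhi_pos x).ne'
      simp only [f]; rw [div_mul_cancel₀ _ hp, hsum]; rfl
    · exact hd x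
  refine ⟨f, ⟨fun x => (hf x).differentiableAt, fun x => (hf2 x).differentiableAt,
    fun x => (main x).1, fun x => ?_, fun x => ?_⟩, fun x => ?_⟩
  · rw [(hf x).deriv]; exact (main x).2.1
  · rw [(hf2 x).deriv]; exact (main x).2.2
  · rw [(hf x).deriv]; ring

lemma smooth_approx {h : ℝ → ℝ} (hL : LipschitzWith 1 h) {ε : ℝ} (hε : 0 < ε) :
    ∃ k : ℝ → ℝ, LipschitzWith 1 k ∧ Differentiable ℝ k ∧ ∀ x, |h x - k x| ≤ ε := by
  have hc := hL.continuous
  have hI : ∀ x, HasDerivAt (fun x => ∫ t in (0:ℝ)..x, h t) (h x) x := fun x =>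
    intervalIntegral.integral_hasDerivAt_right (hc.intervalIntegrable _ _)
      (hc.stronglyMeasurableAtFilter _ _) hc.continuousAt
  let k : ℝ → ℝ := fun x => ε⁻¹ * ((∫ t in (0:ℝ)..(x + ε), h t) - ∫ t in (0:ℝ)..x, h t)
  have hk : ∀ x, HasDerivAt k (ε⁻¹ * (h (x + ε) - h x)) x := fun x =>
    (((hI (x + ε)).comp_add_const x ε).sub (hI x)).const_mul _
  refine ⟨k, ?_, fun x => (hk x).differentiableAt, fun x => ?_⟩
  · apply lipschitzWith_of_nnnorm_deriv_le (fun x => (hk x).differentiableAt)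
    intro x
    rw [(hk x).deriv, ← NNReal.coe_le_coe, coe_nnnorm, Real.norm_eq_abs, abs_mul,
      abs_of_pos (inv_pos.2 hε), inv_mul_le_iff₀ hε]
    have := lip_abs hL (x + ε) x
    simpa [abs_of_pos hε] using this
  · have h1 : h x - k x = ε⁻¹ * ∫ t in x..(x + ε), (h x - h t) := by
      rw [intervalIntegral.integral_sub (by simp) (hc.intervalIntegrable _ _)]
      simp only [k]
      rw [intervalIntegral.integral_interval_sub_left (hc.intervalIntegrable _ _) (hc.intervalIntegrable _ _)]
      simp; field_simp
    have h2 : ‖∫ t in x..(x + ε), (h x - h t)‖ ≤ ε * |x + ε - x| := by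
      apply intervalIntegral.norm_integral_le_of_norm_le_const
      intro t ht
      rw [uIoc_of_le (by linarith)] at ht
      have := lip_abs hL x t
      rw [abs_sub_comm x t, abs_of_nonneg (a := t - x) (by linarith [ht.1])] at this
      rw [Real.norm_eq_abs]
      linarith [ht.2]
    rw [h1, abs_mul, abs_of_pos (inv_pos.2 hε), inv_mul_le_iff₀ hε]
    simpa [abs_of_pos hε] using h2

lemma int_diff {Ω : Type*} [MeasurableSpace Ω] {μ : Measure Ω} [IsProbabilityMeasure μ] {R : Ω → ℝ}
    (hR : Integrable R μ) {h k : ℝ → ℝ} (hL : LipschitzWith 1 h) (kL : LipschitzWith 1 k) {ε : ℝ}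
    (hk : ∀ x, |h x - k x| ≤ ε) : |(∫ ω, h (R ω) ∂μ) - ∫ ω, k (R ω) ∂μ| ≤ ε := by
  rw [← integral_sub (lip_int hR hL) (lip_int hR kL)]
  have := norm_integral_le_of_norm_le_const (μ := μ) (C := ε) (f := fun ω => h (R ω) - k (R ω))
    (ae_of_all _ fun ω => hk (R ω))
  simpa using this

end SteinAux

open MeasureTheory ProbabilityTheory

theorem stein_method_wasserstein_bound
    {Ω : Type*} [MeasurableSpace Ω] (μ : Measure Ω) [IsProbabilityMeasure μ]
    (R : Ω → ℝ) (hRmeas : Measurable R) (hRint : Integrable R μ) :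
    (⨆ h ∈ {h : ℝ → ℝ | LipschitzWith 1 h},
        |(∫ ω, h (R ω) ∂μ) - ∫ x, h x ∂(gaussianReal 0 1)|) ≤
      ⨆ f ∈ {f : ℝ → ℝ | Differentiable ℝ f ∧ Differentiable ℝ (deriv f) ∧
          (∀ x, |f x| ≤ 2) ∧ (∀ x, |deriv f x| ≤ Real.sqrt (2 / Real.pi)) ∧
          (∀ x, |deriv (deriv f) x| ≤ 2)},
        |∫ ω, (deriv f (R ω) - R ω * f (R ω)) ∂μ| := by
  have hnn : 0 ≤ ⨆ f ∈ {f : ℝ → ℝ | Differentiable ℝ f ∧ Differentiable ℝ (deriv f) ∧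
          (∀ x, |f x| ≤ 2) ∧ (∀ x, |deriv f x| ≤ Real.sqrt (2 / Real.pi)) ∧
          (∀ x, |deriv (deriv f) x| ≤ 2)},
        |∫ ω, (deriv f (R ω) - R ω * f (R ω)) ∂μ| :=
    Real.iSup_nonneg fun f => Real.iSup_nonneg fun _ => abs_nonneg _
  refine Real.iSup_le (fun h => Real.iSup_le (fun hL => ?_) hnn) hnn
  have hL : LipschitzWith 1 h := hL
  apply le_of_forall_pos_le_add
  intro ε hε
  obtain ⟨k, kL, kD, hk⟩ := SteinAux.smooth_approx hL (half_pos hε)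
  obtain ⟨f, hf, hfe⟩ := SteinAux.stein_sol kL kD
  have hgi : Integrable (fun x : ℝ => x) (gaussianReal 0 1) :=
    (memLp_id_gaussianReal (μ := 0) (v := 1) 1).integrable (by simp)
  have h1 := SteinAux.int_diff hRint hL kL hk
  have h2 := SteinAux.int_diff hgi hL kL hk
  have h3 : ∫ ω, (deriv f (R ω) - R ω * f (R ω)) ∂μ
      = (∫ ω, k (R ω) ∂μ) - ∫ x, k x ∂(gaussianReal 0 1) := by
    simp_rw [hfe]
    rw [integral_sub (SteinAux.lip_int hRint kL) (integrable_const _)]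
    simp
  have h4 : |∫ ω, (deriv f (R ω) - R ω * f (R ω)) ∂μ| ≤
      ⨆ f ∈ {f : ℝ → ℝ | Differentiable ℝ f ∧ Differentiable ℝ (deriv f) ∧
          (∀ x, |f x| ≤ 2) ∧ (∀ x, |deriv f x| ≤ Real.sqrt (2 / Real.pi)) ∧
          (∀ x, |deriv (deriv f) x| ≤ 2)},
        |∫ ω, (deriv f (R ω) - R ω * f (R ω)) ∂μ| := by
    refine le_ciSup_of_le ?_ f (le_ciSup_of_le ?_ hf le_rfl)
    · refine ⟨∫ ω, (Real.sqrt (2 / Real.pi) + |R ω| * 2) ∂μ, ?_⟩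
      rintro _ ⟨g, rfl⟩
      refine Real.iSup_le (fun hg => ?_) (integral_nonneg fun ω => by positivity)
      refine norm_integral_le_of_norm_le (f := fun ω => deriv g (R ω) - R ω * g (R ω))
        ((integrable_const _).add (hRint.abs.mul_const 2)) (ae_of_all _ fun ω => ?_)
      refine (norm_sub_le _ _).trans ?_
      rw [norm_mul]
      exact add_le_add (hg.2.2.2.1 _) (mul_le_mul_of_nonneg_left (hg.2.2.1 _) (abs_nonneg _))
    · refine ⟨|∫ ω, (deriv f (R ω) - R ω * f (R ω)) ∂μ|, ?_⟩
      rintro _ ⟨_, rfl⟩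
      exact le_rfl
  rw [h3] at h4
  refine le_trans ?_ (add_le_add_left h4 ε)
  rw [abs_le] at h1 h2
  have := neg_abs_le ((∫ ω, k (R ω) ∂μ) - ∫ x, k x ∂(gaussianReal 0 1))
  have := le_abs_self ((∫ ω, k (R ω) ∂μ) - ∫ x, k x ∂(gaussianReal 0 1))
  rw [abs_le]
  constructor <;> linarith [h1.1, h1.2, h2.1, h2.2]
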